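/- arXiv:2205.14595 — 3 statements merged into one kernel-verified Lean document; each statement's English description precedes it below -/
import Mathlib

section
/- Proposition 1 (robust linearization of the legitimate-reception constraint). Define the column vectors v⁰ = [w⁰ ; w⁰ ⊗ (u⁰)^*] ∈ ℂ^{N+MN} and v = [w ; w ⊗ u^*] ∈ ℂ^{N+MN}, and the matrices/vectors Ã = v⁰ v^H, Â = v⁰ (v⁰)^H, ã = [ w (w⁰)^H (ĥ + Ĝ^H u⁰) ; (vec(u (ĥ^H + (u⁰)^H Ĝ) w⁰ w^H))^* ], â = [ w⁰ w^H (ĥ + Ĝ^H u) ; (vec(u⁰ (ĥ^H + u^H Ĝ) w (w⁰)^H))^* ], ā = [ w⁰ (w⁰)^H (ĥ + Ĝ^H u⁰) ; (vec(u⁰ (ĥ^H + (u⁰)^H Ĝ) w⁰ (w⁰)^H))^* ], and the scalars ã₀ = (ĥ^H + (u⁰)^H Ĝ) w⁰ w^H (ĥ + Ĝ^H u) and â₀ = (ĥ^H + (u⁰)^H Ĝ) w⁰ (w⁰)^H (ĥ + Ĝ^H u⁰). Set A = Ã + Ã^H − Â, a = ã + â − ā, a₀ = 2 Re{ã₀}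 − â₀. Then for all estimation errors Δh ∈ ℂ^N and ΔG ∈ ℂ^{M×N}, with x = [Δh ; vec((ΔG)^*)] ∈ ℂ^{N+MN}, one has |((ĥ+Δh)^H + u^H (Ĝ+ΔG)) w|² ≥ x^H A x + 2 Re{a^H x} + a₀; moreover, when w = w⁰ and u = u⁰ this inequality holds with equality for all Δh, ΔG. Consequently, for any η ≥ 0 and r ∈ ℝ, the surrogate constraint x^H A x + 2 Re{a^H x} + a₀ ≥ η(2^r − 1) implies |((ĥ+Δh)^H + u^H(Ĝ+ΔG)) w|² ≥ η(2^r − 1). -/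
open Matrix
open scoped BigOperators

/-- Index type for stacked vectors in `ℂ^{N+MN}`; a pair `(j, i)` in the second summand is
the entry of an `M×N` matrix in row `i`, column `j` (columns stacked, matching both the
Kronecker product `w ⊗ u^*` and `vec`). -/
abbrev StackIdx (N M : ℕ) := Fin N ⊕ (Fin N × Fin M)

/-- The stacked vector `[w ; w ⊗ u^*] ∈ ℂ^{N+MN}`. -/
noncomputable def stackBF {N M : ℕ} (w : Fin N → ℂ) (u : Fin M → ℂ) : StackIdx N M → ℂ :=
  Sum.elim w fun p => w p.1 * star (u p.2)

/-- The row channel `(h^H + u^H G)`. -/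
noncomputable def rowCh {N M : ℕ} (h : Fin N → ℂ) (G : Matrix (Fin M) (Fin N) ℂ)
    (u : Fin M → ℂ) : Fin N → ℂ := fun j => star (h j) + ∑ m, star (u m) * G m j

/-- The column channel `(h + G^H u)`. -/
noncomputable def colCh {N M : ℕ} (h : Fin N → ℂ) (G : Matrix (Fin M) (Fin N) ℂ)
    (u : Fin M → ℂ) : Fin N → ℂ := fun j => h j + ∑ m, star (G m j) * u m

theorem star_sum_rowCh_mul {N M : ℕ} (h : Fin N → ℂ) (G : Matrix (Fin M) (Fin N) ℂ)
    (u : Fin M → ℂ) (w : Fin N → ℂ) :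
    ∑ j, star (w j) * colCh h G u j = star (∑ k, rowCh h G u k * w k) := by
  simp [rowCh, colCh, mul_comm]

theorem sum_rowCh_add_mul {N M : ℕ} (h Δh : Fin N → ℂ) (G ΔG : Matrix (Fin M) (Fin N) ℂ)
    (u : Fin M → ℂ) (w : Fin N → ℂ) :
    ∑ j, rowCh (fun t => h t + Δh t) (G + ΔG) u j * w j =
      ∑ j, rowCh h G u j * w j +
        star (Sum.elim Δh fun q : Fin N × Fin M => star (ΔG q.2 q.1)) ⬝ᵥ stackBF w u := by
  simp only [dotProduct, Fintype.sum_sum_type, Fintype.sum_prod_type, Pi.star_apply,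
    Sum.elim_inl, Sum.elim_inr, stackBF, star_star, rowCh, star_add, Matrix.add_apply,
    ← Finset.sum_add_distrib]
  refine Finset.sum_congr rfl fun j _ => ?_
  have key : ∑ m, ΔG m j * (w j * star (u m)) = (∑ m, star (u m) * ΔG m j) * w j := by
    rw [Finset.sum_mul]
    exact Finset.sum_congr rfl fun m _ => by ring
  rw [key]
  simp only [mul_add, Finset.sum_add_distrib]
  ring

theorem elim_eq_star_smul_stackBF {N M : ℕ} (w : Fin N → ℂ) (u : Fin M → ℂ) (s : ℂ) :
    (Sum.elim (fun i => w i * star s) (fun q => star (u q.2 * s * star (w q.1))) :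
      StackIdx N M → ℂ) = star s • stackBF w u := by
  funext i
  rcases i with i | q <;> simp [stackBF] <;> ring

theorem star_dotProduct_vecMulVec_mulVec {ι : Type*} [Fintype ι] (x a b : ι → ℂ) :
    star x ⬝ᵥ (Matrix.vecMulVec a (star b) *ᵥ x) = (star x ⬝ᵥ a) * star (star x ⬝ᵥ b) := by
  rw [Matrix.vecMulVec_mulVec, dotProduct_smul, Matrix.star_dotProduct b, op_smul_eq_mul]

/-- Expansion of the linearization of `‖z‖ ^ 2` at `s₀ + d₀`, evaluated at `s + d`. -/
theorem linearization_eq (s s₀ d d₀ : ℂ) :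
    (d₀ * star d + d * star d₀ - d₀ * star d₀).re
        + 2 * (s₀ * star d + s * star d₀ - s₀ * star d₀).re
        + (2 * (s₀ * star s).re - (s₀ * star s₀).re)
      = ‖s + d‖ ^ 2 - ‖(s + d) - (s₀ + d₀)‖ ^ 2 := by
  simp only [Complex.sq_norm, Complex.normSq_apply, Complex.add_re, Complex.sub_re,
    Complex.mul_re, Complex.add_im, Complex.sub_im, Complex.star_def, Complex.conj_re,
    Complex.conj_im]
  ring

/-- Proposition 1 (robust linearization of the legitimate-reception constraint): with
`v⁰ = [w⁰ ; w⁰ ⊗ (u⁰)^*]`, `v = [w ; w ⊗ u^*]`, `Ã = v⁰ v^H`, `Â = v⁰ (v⁰)^H`, the vectors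
`ã, â, ā` and scalars `ã₀, â₀` as in the paper, `A = Ã + Ã^H − Â`, `a = ã + â − ā`,
`a₀ = 2 Re{ã₀} − â₀`, and the stacked error `x = [Δh ; vec((ΔG)^*)]`, one has
`|((ĥ+Δh)^H + u^H(Ĝ+ΔG)) w|² ≥ x^H A x + 2 Re{a^H x} + a₀` for all `Δh, ΔG`; equality holds
for all `Δh, ΔG` when `w = w⁰` and `u = u⁰`; and consequently, for `η ≥ 0` and `r ∈ ℝ`, the
surrogate constraint `x^H A x + 2 Re{a^H x} + a₀ ≥ η(2^r − 1)` implies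
`|((ĥ+Δh)^H + u^H(Ĝ+ΔG)) w|² ≥ η(2^r − 1)`. -/
theorem proposition1 {N M : ℕ} (hN : 0 < N) (hM : 0 < M)
    (hhat : Fin N → ℂ) (Ghat : Matrix (Fin M) (Fin N) ℂ)
    (w w0 : Fin N → ℂ) (u u0 : Fin M → ℂ) :
    let Atilde : Matrix (StackIdx N M) (StackIdx N M) ℂ :=
      Matrix.vecMulVec (stackBF w0 u0) (star (stackBF w u))
    let Ahat : Matrix (StackIdx N M) (StackIdx N M) ℂ :=
      Matrix.vecMulVec (stackBF w0 u0) (star (stackBF w0 u0))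
    let atilde : StackIdx N M → ℂ :=
      Sum.elim (fun i => w i * ∑ j, star (w0 j) * colCh hhat Ghat u0 j)
        (fun q => star (u q.2 * (∑ k, rowCh hhat Ghat u0 k * w0 k) * star (w q.1)))
    let ahat : StackIdx N M → ℂ :=
      Sum.elim (fun i => w0 i * ∑ j, star (w j) * colCh hhat Ghat u j)
        (fun q => star (u0 q.2 * (∑ k, rowCh hhat Ghat u k * w k) * star (w0 q.1)))
    let abar : StackIdx N M → ℂ :=
      Sum.elim (fun i => w0 i * ∑ j, star (w0 j) * colCh hhat Ghat u0 j)
        (fun q => star (u0 q.2 * (∑ k, rowCh hhat Ghat u0 k * w0 k) * star (w0 q.1)))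
    let atilde₀ : ℂ :=
      (∑ k, rowCh hhat Ghat u0 k * w0 k) * ∑ j, star (w j) * colCh hhat Ghat u j
    let ahat₀ : ℂ :=
      (∑ k, rowCh hhat Ghat u0 k * w0 k) * ∑ j, star (w0 j) * colCh hhat Ghat u0 j
    let A : Matrix (StackIdx N M) (StackIdx N M) ℂ := Atilde + Atildeᴴ - Ahat
    let a : StackIdx N M → ℂ := atilde + ahat - abar
    let a₀ : ℝ := 2 * atilde₀.re - ahat₀.re
    let quad : (StackIdx N M → ℂ) → ℝ := fun x =>
      (star x ⬝ᵥ (A *ᵥ x)).re + 2 * (star a ⬝ᵥ x).re + a₀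
    let xvec : (Fin N → ℂ) → Matrix (Fin M) (Fin N) ℂ → StackIdx N M → ℂ := fun Δh ΔG =>
      Sum.elim Δh fun q => star (ΔG q.2 q.1)
    let gain : (Fin N → ℂ) → Matrix (Fin M) (Fin N) ℂ → ℝ := fun Δh ΔG =>
      ‖∑ j, rowCh (fun t => hhat t + Δh t) (Ghat + ΔG) u j * w j‖ ^ 2
    (∀ (Δh : Fin N → ℂ) (ΔG : Matrix (Fin M) (Fin N) ℂ),
        quad (xvec Δh ΔG) ≤ gain Δh ΔG) ∧
    (w = w0 → u = u0 →
      ∀ (Δh : Fin N → ℂ) (ΔG : Matrix (Fin M) (Fin N) ℂ),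
        quad (xvec Δh ΔG) = gain Δh ΔG) ∧
    (∀ (η r : ℝ), 0 ≤ η →
      ∀ (Δh : Fin N → ℂ) (ΔG : Matrix (Fin M) (Fin N) ℂ),
        η * ((2 : ℝ) ^ r - 1) ≤ quad (xvec Δh ΔG) →
          η * ((2 : ℝ) ^ r - 1) ≤ gain Δh ΔG) := by
  intro Atilde Ahat atilde ahat abar atilde₀ ahat₀ A a a₀ quad xvec gain
  have key (Δh : Fin N → ℂ) (ΔG : Matrix (Fin M) (Fin N) ℂ) :
      quad (xvec Δh ΔG) = gain Δh ΔG -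
        ‖∑ j, rowCh (fun t => hhat t + Δh t) (Ghat + ΔG) u j * w j -
          ∑ j, rowCh (fun t => hhat t + Δh t) (Ghat + ΔG) u0 j * w0 j‖ ^ 2 := by
    simp only [quad, gain, xvec, a₀, a, A, atilde₀, ahat₀, atilde, ahat, abar, Atilde, Ahat,
      star_sum_rowCh_mul, sum_rowCh_add_mul, elim_eq_star_smul_stackBF]
    rw [← linearization_eq]
    simp only [Matrix.sub_mulVec, Matrix.add_mulVec, dotProduct_sub, dotProduct_add,
      Matrix.conjTranspose_vecMulVec, star_star, star_dotProduct_vecMulVec_mulVec,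
      star_sub, star_add, star_smul, sub_dotProduct, add_dotProduct, smul_dotProduct,
      smul_eq_mul]
    simp only [Matrix.star_dotProduct (stackBF _ _)]
  have le (Δh : Fin N → ℂ) (ΔG : Matrix (Fin M) (Fin N) ℂ) :
      quad (xvec Δh ΔG) ≤ gain Δh ΔG := by
    rw [key]
    exact sub_le_self _ (sq_nonneg _)
  refine ⟨le, ?_, fun _ _ _ Δh ΔG h => h.trans (le Δh ΔG)⟩
  intro hw hu Δh ΔG
  rw [key, hw, hu]
  simp
end

section
/- Complex S-lemma (Lemma 1 with a single constraint, both directions): let n be a positive integer, A_0, A_1 ∈ ℂ^{n×n} Hermitian, a_0, a_1 ∈ ℂ^n, c_0, c_1 ∈ ℝ, and define f_i(x) = x^H A_i x + 2 Re{a_i^H x} + c_i for i = 0,1. Assume the Slater condition: there exists x̂ ∈ ℂ^n with f_1(x̂) > 0. Then the implication (for all x ∈ ℂ^n, f_1(x) ≥ 0 implies f_0(x) ≥ 0) holds if and only if there exists υ ≥ 0 such that the (n+1)×(n+1) Hermitian block matrix [[A_0, a_0],[a_0^H, c_0]] − υ [[A_1, a_1],[a_1^H, c_1]] is positive semidefinite.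 -/
open Matrix
open scoped BigOperators ComplexOrder

/-- The real part of the sesquilinear form `z^H M z`. -/
def reQuadForm {m : Type*} [Fintype m] (M : Matrix m m ℂ) (z : m → ℂ) : ℝ :=
  (star z ⬝ᵥ (M *ᵥ z)).re

section reQuadForm

variable {m : Type*} [Fintype m]

lemma Matrix.IsHermitian.reQuadForm_add_smul {M : Matrix m m ℂ} (hM : M.IsHermitian)
    (z w : m → ℂ) (c : ℂ) :
    reQuadForm M (z + c • w) =
      reQuadForm M z + Complex.normSq c * reQuadForm M w
        + 2 * (c * (star z ⬝ᵥ (M *ᵥ w))).re := by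
  have hsymm : star w ⬝ᵥ (M *ᵥ z) = star (star z ⬝ᵥ (M *ᵥ w)) := by
    rw [← star_dotProduct_star, star_star, star_mulVec, hM.eq, ← dotProduct_mulVec]
  simp only [reQuadForm, star_add, star_smul, mulVec_add, mulVec_smul, add_dotProduct,
    dotProduct_add, smul_dotProduct, dotProduct_smul, smul_eq_mul, hsymm, Complex.add_re,
    Complex.add_im, Complex.mul_re, Complex.mul_im, Complex.star_def, Complex.conj_re, Complex.conj_im,
    Complex.normSq_apply]
  ring

lemma reQuadForm_smul (M : Matrix m m ℂ) (z : m → ℂ) (c : ℂ) :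
    reQuadForm M (c • z) = Complex.normSq c * reQuadForm M z := by
  simp only [reQuadForm, star_smul, mulVec_smul, smul_dotProduct, dotProduct_smul, smul_eq_mul,
    Complex.mul_re, Complex.mul_im, Complex.star_def, Complex.conj_re, Complex.conj_im,
    Complex.normSq_apply]
  ring

lemma reQuadForm_sub_smul (M N : Matrix m m ℂ) (r : ℝ) (z : m → ℂ) :
    reQuadForm (M - (r : ℂ) • N) z = reQuadForm M z - r * reQuadForm N z := by
  simp [reQuadForm, sub_mulVec, smul_mulVec, dotProduct_sub, dotProduct_smul]

lemma Matrix.IsHermitian.posSemidef_of_reQuadForm_nonneg {M : Matrix m m ℂ} (hM : M.IsHermitian)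
    (h : ∀ z, 0 ≤ reQuadForm M z) : M.PosSemidef :=
  .of_dotProduct_mulVec_nonneg hM fun z =>
    Complex.nonneg_iff.2 ⟨h z, (hM.im_star_dotProduct_mulVec_self z).symm⟩

end reQuadForm

/-- A complex number of prescribed modulus can be rotated so that its product with `b₁` is purely
imaginary and its product with `b₀` has nonpositive real part. -/
lemma Complex.exists_normSq_eq_re_mul_eq_zero (b₀ b₁ : ℂ) {r : ℝ} (hr : 0 ≤ r) :
    ∃ c : ℂ, Complex.normSq c = r ∧ (c * b₁).re = 0 ∧ (c * b₀).re ≤ 0 := by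
  obtain ⟨c, hc, hc₁⟩ : ∃ c : ℂ, Complex.normSq c = r ∧ (c * b₁).re = 0 := by
    rcases eq_or_ne b₁ 0 with rfl | hb
    · exact ⟨(√r : ℝ), by simp [Complex.normSq_ofReal, Real.mul_self_sqrt hr], by simp⟩
    · have hb' : Complex.normSq b₁ ≠ 0 := by simpa using hb
      refine ⟨(√(r / Complex.normSq b₁) : ℝ) * (Complex.I * star b₁), ?_, ?_⟩
      · rw [Complex.normSq_mul, Complex.normSq_ofReal,
          Real.mul_self_sqrt (div_nonneg hr (Complex.normSq_nonneg _))]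
        simp [field]
      · simp [Complex.mul_re, Complex.mul_im]
        ring
  rcases le_total (c * b₀).re 0 with h | h
  · exact ⟨c, hc, hc₁, h⟩
  · exact ⟨-c, by simpa using hc, by rw [neg_mul, Complex.neg_re, hc₁, neg_zero],
      by rwa [neg_mul, Complex.neg_re, neg_nonpos]⟩

/-- A real quadratic polynomial that is nonnegative on the nonnegative half-line has nonnegative
leading coefficient. -/
lemma leadingCoeff_nonneg_of_quadratic_nonneg {a b q : ℝ}
    (h : ∀ s : ℝ, 0 ≤ s → 0 ≤ a + s * b + s ^ 2 * q) : 0 ≤ q := by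
  by_contra! hq
  set s := 1 + (|a| + |b|) / (-q) with hs
  have hs1 : 1 ≤ s := le_add_of_nonneg_right (div_nonneg (by positivity) (by linarith))
  have hsq : s * q = q - (|a| + |b|) := by
    have := hq.ne
    rw [hs]
    field_simp
    ring
  have ha : a ≤ s * |a| := by nlinarith [le_abs_self a, abs_nonneg a]
  have hb : s * b ≤ s * |b| := by gcongr; exact le_abs_self b
  nlinarith [h s (by linarith), congrArg (s * ·) hsq]

/-- The homogeneous S-lemma for two Hermitian forms. -/
theorem exists_posSemidef_sub_smul_of_reQuadForm_nonneg {m : Type*} [Fintype m]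
    {M₀ M₁ : Matrix m m ℂ} (hM₀ : M₀.IsHermitian) (hM₁ : M₁.IsHermitian)
    (hslater : ∃ z, 0 < reQuadForm M₁ z)
    (h : ∀ z, 0 ≤ reQuadForm M₁ z → 0 ≤ reQuadForm M₀ z) :
    ∃ υ : ℝ, 0 ≤ υ ∧ (M₀ - (υ : ℂ) • M₁).PosSemidef := by
  have hcross : ∀ z w, 0 < reQuadForm M₁ z → reQuadForm M₁ w < 0 →
      reQuadForm M₀ w / reQuadForm M₁ w ≤ reQuadForm M₀ z / reQuadForm M₁ z := by
    intro z w hz hw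
    have hr : 0 ≤ -(reQuadForm M₁ z / reQuadForm M₁ w) :=
      neg_nonneg.2 (div_nonpos_of_nonneg_of_nonpos hz.le hw.le)
    obtain ⟨c, hc, hc₁, hc₀⟩ := Complex.exists_normSq_eq_re_mul_eq_zero
      (star z ⬝ᵥ (M₀ *ᵥ w)) (star z ⬝ᵥ (M₁ *ᵥ w)) hr
    have h₁ : reQuadForm M₁ (z + c • w) = 0 := by
      rw [hM₁.reQuadForm_add_smul, hc, hc₁]
      have := hw.ne
      field_simp
      ring
    have h₀ := h _ h₁.ge
    rw [hM₀.reQuadForm_add_smul, hc] at h₀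
    have hsum : 0 ≤ reQuadForm M₀ z -
        reQuadForm M₁ z * (reQuadForm M₀ w / reQuadForm M₁ w) := by
      have : reQuadForm M₁ z / reQuadForm M₁ w * reQuadForm M₀ w =
          reQuadForm M₁ z * (reQuadForm M₀ w / reQuadForm M₁ w) := by ring
      linarith
    rw [le_div_iff₀ hz]
    linarith
  set S : Set ℝ := (fun z => reQuadForm M₀ z / reQuadForm M₁ z) '' {z | 0 < reQuadForm M₁ z}
    with hS
  have hne : S.Nonempty := Set.Nonempty.image _ hslater
  have hnonneg : ∀ r ∈ S, 0 ≤ r := by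
    rintro _ ⟨z, hz, rfl⟩
    exact div_nonneg (h z (le_of_lt hz)) (le_of_lt hz)
  refine ⟨sInf S, le_csInf hne hnonneg, ?_⟩
  refine IsHermitian.posSemidef_of_reQuadForm_nonneg
    (hM₀.sub (hM₁.smul (by simp [IsSelfAdjoint]))) fun z => ?_
  rw [reQuadForm_sub_smul, sub_nonneg]
  rcases lt_trichotomy (reQuadForm M₁ z) 0 with hz | hz | hz
  · have : reQuadForm M₀ z / reQuadForm M₁ z ≤ sInf S := by
      refine le_csInf hne ?_
      rintro _ ⟨y, hy, rfl⟩
      exact hcross y z hy hz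
    rwa [div_le_iff_of_neg hz] at this
  · simpa [hz] using h z hz.ge
  · rw [← le_div_iff₀ hz]
    exact csInf_le ⟨0, hnonneg⟩ ⟨z, hz, rfl⟩

/-- Bordering a Hermitian matrix by a vector and a real number gives a Hermitian matrix. -/
lemma Matrix.IsHermitian.fromBlocks_border {n : ℕ} {A : Matrix (Fin n) (Fin n) ℂ}
    (hA : A.IsHermitian) (a : Fin n → ℂ) (c : ℝ) :
    (Matrix.fromBlocks A (Matrix.of fun r (_ : Fin 1) => a r)
      (Matrix.of fun (_ : Fin 1) j => star (a j))
      (Matrix.of fun (_ _ : Fin 1) => (c : ℂ))).IsHermitian := by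
  refine hA.fromBlocks ?_ ?_
  · ext i j
    simp
  · ext i j
    simp

lemma reQuadForm_fromBlocks_border {n : ℕ} (A : Matrix (Fin n) (Fin n) ℂ) (a : Fin n → ℂ) (c : ℝ)
    (x : Fin n → ℂ) :
    reQuadForm (Matrix.fromBlocks A (Matrix.of fun r (_ : Fin 1) => a r)
      (Matrix.of fun (_ : Fin 1) j => star (a j))
      (Matrix.of fun (_ _ : Fin 1) => (c : ℂ))) (Sum.elim x 1) =
      (star x ⬝ᵥ (A *ᵥ x)).re + 2 * (star a ⬝ᵥ x).re + c := by
  have hstar : star (Sum.elim x (1 : Fin 1 → ℂ)) = Sum.elim (star x) 1 := by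
    ext (i | i) <;> simp
  have hcol : (Matrix.of fun r (_ : Fin 1) => a r) *ᵥ 1 = a := by
    ext i
    simp [mulVec, dotProduct]
  have hrow : (Matrix.of fun (_ : Fin 1) j => star (a j)) *ᵥ x = fun _ => star a ⬝ᵥ x := rfl
  have hre : (star x ⬝ᵥ a).re = (star a ⬝ᵥ x).re := by
    rw [star_dotProduct, Complex.star_def, Complex.conj_re]
  rw [reQuadForm, fromBlocks_mulVec, hstar, sumElim_dotProduct_sumElim]
  simp only [Sum.elim_comp_inl, Sum.elim_comp_inr, hcol, hrow, dotProduct_add, Complex.add_re, hre]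
  simp [dotProduct, mulVec]
  ring

/-- Complex S-lemma (Lemma 1 with a single constraint, both directions): with
`f_i(x) = x^H A_i x + 2 Re{a_i^H x} + c_i` (`A_i` Hermitian) and the Slater condition
`∃ xhat, f₁(xhat) > 0`, the implication `(∀ x, f₁(x) ≥ 0 → f₀(x) ≥ 0)` holds iff there exists
`υ ≥ 0` with `[[A₀,a₀],[a₀^H,c₀]] − υ [[A₁,a₁],[a₁^H,c₁]]` positive semidefinite. -/
theorem complex_s_lemma {n : ℕ} (hn : 0 < n)
    (A₀ A₁ : Matrix (Fin n) (Fin n) ℂ) (a₀ a₁ : Fin n → ℂ) (c₀ c₁ : ℝ)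
    (hA₀ : A₀.IsHermitian) (hA₁ : A₁.IsHermitian) :
    let f₀ : (Fin n → ℂ) → ℝ := fun x =>
      (star x ⬝ᵥ (A₀ *ᵥ x)).re + 2 * (star a₀ ⬝ᵥ x).re + c₀
    let f₁ : (Fin n → ℂ) → ℝ := fun x =>
      (star x ⬝ᵥ (A₁ *ᵥ x)).re + 2 * (star a₁ ⬝ᵥ x).re + c₁
    let M₀ : Matrix (Fin n ⊕ Fin 1) (Fin n ⊕ Fin 1) ℂ :=
      Matrix.fromBlocks A₀ (Matrix.of fun r (_ : Fin 1) => a₀ r)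
        (Matrix.of fun (_ : Fin 1) j => star (a₀ j)) (Matrix.of fun (_ _ : Fin 1) => (c₀ : ℂ))
    let M₁ : Matrix (Fin n ⊕ Fin 1) (Fin n ⊕ Fin 1) ℂ :=
      Matrix.fromBlocks A₁ (Matrix.of fun r (_ : Fin 1) => a₁ r)
        (Matrix.of fun (_ : Fin 1) j => star (a₁ j)) (Matrix.of fun (_ _ : Fin 1) => (c₁ : ℂ))
    (∃ xhat : Fin n → ℂ, 0 < f₁ xhat) →
      ((∀ x : Fin n → ℂ, 0 ≤ f₁ x → 0 ≤ f₀ x) ↔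
        ∃ υ : ℝ, 0 ≤ υ ∧ (M₀ - (υ : ℂ) • M₁).PosSemidef) := by
  intro f₀ f₁ M₀ M₁ hslater
  have hM₀ : M₀.IsHermitian := hA₀.fromBlocks_border a₀ c₀
  have hM₁ : M₁.IsHermitian := hA₁.fromBlocks_border a₁ c₁
  have hf₀ : ∀ x, reQuadForm M₀ (Sum.elim x 1) = f₀ x := reQuadForm_fromBlocks_border A₀ a₀ c₀
  have hf₁ : ∀ x, reQuadForm M₁ (Sum.elim x 1) = f₁ x := reQuadForm_fromBlocks_border A₁ a₁ c₁
  obtain ⟨xhat, hxhat⟩ := hslater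
  constructor
  · intro h
    refine exists_posSemidef_sub_smul_of_reQuadForm_nonneg hM₀ hM₁
      ⟨Sum.elim xhat 1, by rwa [hf₁]⟩ fun z hz => ?_
    by_cases ht : z (Sum.inr 0) = 0
    · have hline : ∀ c : ℂ, Sum.elim xhat 1 + c • z =
          Sum.elim (xhat + c • (z ∘ Sum.inl)) 1 := by
        intro c
        ext (i | i)
        · simp
        · simp [Subsingleton.elim i 0, ht]
      obtain ⟨ε, hε, hεre⟩ : ∃ ε : ℝ, ε ^ 2 = 1 ∧
          0 ≤ ε * (star (Sum.elim xhat 1) ⬝ᵥ (M₁ *ᵥ z)).re := by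
        rcases le_total 0 (star (Sum.elim xhat 1) ⬝ᵥ (M₁ *ᵥ z)).re with hb | hb
        · exact ⟨1, by simp, by simpa using hb⟩
        · exact ⟨-1, by simp, by simpa using hb⟩
      refine leadingCoeff_nonneg_of_quadratic_nonneg (a := f₀ xhat)
        (b := 2 * (ε * (star (Sum.elim xhat 1) ⬝ᵥ (M₀ *ᵥ z)).re)) fun s hs => ?_
      have hsq : Complex.normSq ((s * ε : ℝ) : ℂ) = s ^ 2 := by
        rw [Complex.normSq_ofReal]
        linear_combination s ^ 2 * hε
      have h₁ := hM₁.reQuadForm_add_smul (Sum.elim xhat 1) z ((s * ε : ℝ) : ℂ)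
      have h₀ := hM₀.reQuadForm_add_smul (Sum.elim xhat 1) z ((s * ε : ℝ) : ℂ)
      rw [hline, hf₁, hf₁, hsq, Complex.re_ofReal_mul] at h₁
      rw [hline, hf₀, hf₀, hsq, Complex.re_ofReal_mul] at h₀
      have hnonneg := h (xhat + ((s * ε : ℝ) : ℂ) • (z ∘ Sum.inl)) (by
        rw [h₁]
        have := mul_nonneg hs hεre
        have := mul_nonneg (sq_nonneg s) hz
        linarith)
      rw [h₀] at hnonneg
      linarith
    · have hz' : z = z (Sum.inr 0) • Sum.elim ((z (Sum.inr 0))⁻¹ • (z ∘ Sum.inl)) 1 := by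
        ext (i | i)
        · simp [ht]
        · simp [Subsingleton.elim i 0]
      have hpos : 0 < Complex.normSq (z (Sum.inr 0)) := Complex.normSq_pos.2 ht
      rw [hz', reQuadForm_smul, hf₁] at hz
      rw [hz', reQuadForm_smul, hf₀]
      exact mul_nonneg hpos.le (h _ (nonneg_of_mul_nonneg_right hz hpos))
  · rintro ⟨υ, hυ, hpsd⟩ x hx
    have hnonneg : 0 ≤ reQuadForm (M₀ - (υ : ℂ) • M₁) (Sum.elim x 1) :=
      hpsd.re_dotProduct_nonneg _
    rw [reQuadForm_sub_smul, hf₀, hf₁] at hnonneg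
    linarith [mul_nonneg hυ hx]
end

section
/- General sign-definiteness, sufficiency direction (Lemma 2): let n and I be positive integers, let A ∈ ℂ^{n×n} be Hermitian, and for each i ∈ {1,…,I} let E_i ∈ ℂ^{m_i×n}, F_i ∈ ℂ^{p_i×n}, and ξ_i ≥ 0. Suppose there exist nonnegative reals ϖ_1, …, ϖ_I such that the Hermitian block matrix of size n + Σ_i m_i whose (0,0) block is A − Σ_{i=1}^{I} ϖ_i F_i^H F_i, whose (0,i) block is −ξ_i E_i^H and (i,0) block is −ξ_i E_i for each i, whose (i,i) block is ϖ_i I_{m_i}, and whose off-diagonal blocks between distinct i and i' are zero, is positive semidefinite. Then for every choice of matrices G_i ∈ ℂ^{m_i×p_i} with Frobenius norm ‖G_i‖_F ≤ ξ_i (i = 1,…,I), the matrix A − Σ_{i=1}^{I} (E_i^H G_i F_i + F_i^H G_i^H E_i) is positive semidefinite. -/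
open Matrix
open scoped BigOperators ComplexOrder

/-- The vertical concatenation of a family of matrices with a common set of columns. -/
def Matrix.vstack {ι n R : Type*} {m : ι → Type*} (X : ∀ i, Matrix (m i) n R) :
    Matrix (Σ i, m i) n R :=
  Matrix.of fun q c => X q.1 q.2 c

theorem Matrix.conjTranspose_vstack_mul_vstack {ι n k R : Type*} {m : ι → Type*} [Fintype ι]
    [∀ i, Fintype (m i)] [NonUnitalSemiring R] [StarRing R]
    (X : ∀ i, Matrix (m i) n R) (Y : ∀ i, Matrix (m i) k R) :
    (vstack X)ᴴ * vstack Y = ∑ i, (X i)ᴴ * Y i := by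
  ext r c
  simp [vstack, Matrix.mul_apply, Matrix.sum_apply, Fintype.sum_sigma]

theorem Matrix.blockDiagonal'_smul_one_mul_vstack {ι n R : Type*} {m : ι → Type*} [Fintype ι]
    [DecidableEq ι] [∀ i, Fintype (m i)] [∀ i, DecidableEq (m i)] [CommSemiring R]
    (d : ι → R) (Y : ∀ i, Matrix (m i) n R) :
    blockDiagonal' (fun i => d i • (1 : Matrix (m i) (m i) R)) * vstack Y =
      vstack fun i => d i • Y i := by
  have h : blockDiagonal' (fun i => d i • (1 : Matrix (m i) (m i) R)) =
      diagonal fun q : Σ i, m i => d q.1 := by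
    simp only [smul_one_eq_diagonal, blockDiagonal'_diagonal]
  ext q c
  simp [h, vstack]

theorem Complex.star_dotProduct_self {m : Type*} [Fintype m] (v : m → ℂ) :
    star v ⬝ᵥ v = ((∑ j, ‖v j‖ ^ 2 : ℝ) : ℂ) := by
  simp [dotProduct, Complex.conj_mul']

/-- A matrix whose Frobenius norm is at most one is a contraction. -/
theorem Matrix.posSemidef_one_sub_conjTranspose_mul_self {m n : Type*} [Fintype m] [Fintype n]
    [DecidableEq n] (H : Matrix m n ℂ) (hH : ∑ r, ∑ c, ‖H r c‖ ^ 2 ≤ 1) :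
    (1 - Hᴴ * H).PosSemidef := by
  refine .of_dotProduct_mulVec_nonneg
    (isHermitian_one.sub (isHermitian_conjTranspose_mul_self H)) fun x => ?_
  rw [sub_mulVec, one_mulVec, dotProduct_sub, ← mulVec_mulVec, dotProduct_mulVec _ Hᴴ,
    ← star_mulVec, Complex.star_dotProduct_self,
    Complex.star_dotProduct_self, ← Complex.ofReal_sub, Complex.zero_le_real, sub_nonneg]
  have row (r : m) : ‖(H *ᵥ x) r‖ ^ 2 ≤ (∑ c, ‖H r c‖ ^ 2) * ∑ c, ‖x c‖ ^ 2 := by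
    calc ‖(H *ᵥ x) r‖ ^ 2 ≤ (∑ c, ‖H r c‖ * ‖x c‖) ^ 2 := by
          gcongr
          simpa [mulVec, dotProduct] using norm_sum_le Finset.univ fun c => H r c * x c
      _ ≤ _ := Finset.sum_mul_sq_le_sq_mul_sq _ _ _
  calc ∑ r, ‖(H *ᵥ x) r‖ ^ 2 ≤ ∑ r, (∑ c, ‖H r c‖ ^ 2) * ∑ c, ‖x c‖ ^ 2 :=
        Finset.sum_le_sum fun r _ => row r
    _ = (∑ r, ∑ c, ‖H r c‖ ^ 2) * ∑ c, ‖x c‖ ^ 2 := by rw [Finset.sum_mul]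
    _ ≤ ∑ c, ‖x c‖ ^ 2 := mul_le_of_le_one_left (by positivity) hH

/-- A matrix whose Frobenius norm is at most `ξ` is `ξ` times a contraction. -/
theorem Matrix.exists_eq_smul_of_frobenius_le {m n : Type*} [Fintype m] [Fintype n]
    [DecidableEq n] (G : Matrix m n ℂ) {ξ : ℝ} (hξ : 0 ≤ ξ)
    (hG : Real.sqrt (∑ r, ∑ c, ‖G r c‖ ^ 2) ≤ ξ) :
    ∃ H : Matrix m n ℂ, G = (ξ : ℂ) • H ∧ (1 - Hᴴ * H).PosSemidef := by
  rw [Real.sqrt_le_left hξ] at hG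
  rcases hξ.eq_or_lt with rfl | hpos
  · refine ⟨0, ?_, by simpa using PosSemidef.one⟩
    have entry (r : m) (c : n) : ‖G r c‖ ^ 2 ≤ ∑ r, ∑ c, ‖G r c‖ ^ 2 :=
      (Finset.single_le_sum (f := fun c => ‖G r c‖ ^ 2) (fun _ _ => by positivity)
        (Finset.mem_univ c)).trans
      (Finset.single_le_sum (f := fun r => ∑ c, ‖G r c‖ ^ 2) (fun _ _ => by positivity)
        (Finset.mem_univ r))
    ext r c
    have := (entry r c).trans hG
    simpa using this
  · refine ⟨(ξ : ℂ)⁻¹ • G, ?_, posSemidef_one_sub_conjTranspose_mul_self _ ?_⟩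
    · rw [smul_inv_smul₀ (by exact_mod_cast hpos.ne')]
    · simp only [smul_apply, norm_smul, mul_pow, ← Finset.mul_sum]
      rw [norm_inv, Complex.norm_of_nonneg hξ, inv_pow, inv_mul_le_iff₀ (by positivity), mul_one]
      exact hG

/-- General sign-definiteness, sufficiency direction (Lemma 2): if there are nonnegative
`ϖ_1,…,ϖ_I` such that the big block matrix with `(0,0)` block `A − Σ_i ϖ_i F_i^H F_i`,
`(0,i)` blocks `−ξ_i E_i^H`, `(i,0)` blocks `−ξ_i E_i`, diagonal blocks `ϖ_i I_{m_i}` and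
zero blocks between distinct `i, i'` is positive semidefinite, then for all `G_i` with
Frobenius norm `‖G_i‖_F ≤ ξ_i`, the matrix `A − Σ_i (E_i^H G_i F_i + F_i^H G_i^H E_i)` is
positive semidefinite. -/
theorem general_sign_definiteness_sufficiency {n I : ℕ} (hn : 0 < n) (hI : 0 < I)
    (A : Matrix (Fin n) (Fin n) ℂ) (hA : A.IsHermitian)
    (m p : Fin I → ℕ)
    (E : ∀ i, Matrix (Fin (m i)) (Fin n) ℂ)
    (F : ∀ i, Matrix (Fin (p i)) (Fin n) ℂ)
    (ξ : Fin I → ℝ) (hξ : ∀ i, 0 ≤ ξ i)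
    (ϖ : Fin I → ℝ) (hϖ : ∀ i, 0 ≤ ϖ i)
    (hPSD : (Matrix.fromBlocks
        (A - ∑ i, (ϖ i : ℂ) • ((F i)ᴴ * F i))
        (Matrix.of fun r (q : Σ i : Fin I, Fin (m i)) => -(ξ q.1 : ℂ) * star (E q.1 q.2 r))
        (Matrix.of fun (q : Σ i : Fin I, Fin (m i)) c => -(ξ q.1 : ℂ) * E q.1 q.2 c)
        (Matrix.blockDiagonal'
          fun i => (ϖ i : ℂ) • (1 : Matrix (Fin (m i)) (Fin (m i)) ℂ))).PosSemidef) :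
    ∀ G : (i : Fin I) → Matrix (Fin (m i)) (Fin (p i)) ℂ,
      (∀ i, Real.sqrt (∑ r, ∑ c, ‖G i r c‖ ^ 2) ≤ ξ i) →
      (A - ∑ i, ((E i)ᴴ * G i * F i + (F i)ᴴ * (G i)ᴴ * E i)).PosSemidef := by
  intro G hG
  choose H hGH hH using fun i => exists_eq_smul_of_frobenius_le (G i) (hξ i) (hG i)
  have hcol : (Matrix.of fun (q : Σ i : Fin I, Fin (m i)) c => -(ξ q.1 : ℂ) * E q.1 q.2 c) =
      vstack fun i => (-(ξ i : ℂ)) • E i := rfl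
  have hrow : (Matrix.of fun r (q : Σ i : Fin I, Fin (m i)) =>
      -(ξ q.1 : ℂ) * star (E q.1 q.2 r)) =
      (vstack fun i => (-(ξ i : ℂ)) • E i)ᴴ := by
    ext r q
    simp [vstack]
  rw [hcol, hrow] at hPSD
  have hcompress := hPSD.conjTranspose_mul_mul_same (fromRows 1 (vstack fun i => H i * F i))
  have hslack : (∑ i, (ϖ i : ℂ) • ((F i)ᴴ * (1 - (H i)ᴴ * H i) * F i)).PosSemidef :=
    posSemidef_sum _ fun i _ => ((hH i).conjTranspose_mul_mul_same (F i)).smul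
      (Complex.zero_le_real.2 (hϖ i))
  convert hcompress.add hslack using 1
  have hsymm : (vstack fun i => H i * F i)ᴴ * (vstack fun i => (-(ξ i : ℂ)) • E i) =
      ∑ i, -((F i)ᴴ * (G i)ᴴ * E i) := by
    rw [conjTranspose_vstack_mul_vstack]
    refine Finset.sum_congr rfl fun i _ => ?_
    simp [hGH i, conjTranspose_mul]
  rw [conjTranspose_fromRows_eq_fromCols_conjTranspose, Matrix.mul_assoc,
    fromBlocks_mul_fromRows, fromCols_mul_fromRows, blockDiagonal'_smul_one_mul_vstack,
    conjTranspose_one, Matrix.one_mul, Matrix.mul_one, Matrix.mul_one, Matrix.mul_add, hsymm,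
    conjTranspose_vstack_mul_vstack, conjTranspose_vstack_mul_vstack]
  simp only [sub_eq_add_neg, add_assoc, ← Finset.sum_neg_distrib, ← Finset.sum_add_distrib]
  congr 1
  refine Finset.sum_congr rfl fun i _ => ?_
  simp only [hGH i, conjTranspose_mul, conjTranspose_smul, Matrix.mul_add, Matrix.add_mul,
    Matrix.mul_one, Matrix.mul_neg, Matrix.neg_mul, Matrix.mul_smul, Matrix.smul_mul, smul_add,
    smul_neg, neg_smul, conjTranspose_neg, Matrix.mul_assoc, Complex.star_def, Complex.conj_ofReal]
  abel
end
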